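/- arXiv:1210.2544 — 2 statements merged into one kernel-verified Lean document; each statement's English description precedes it below -/
import Mathlib

section
/- Let (V, m) be a finite multigraph and c : V → Bool a coloring such that every vertex v has at most 2 same-colored neighbors counted with multiplicity, i.e., ∑_{u with c u = c v} m v u ≤ 2. Then there exists f : V → V such that (c, f) is an FO-2-coloring of (V, m). -/
/-- An FO-2-coloring of the multigraph `m`: a 2-coloring `c` together with a
function `f` such that the submultigraph induced by each color class has a
full functional orientation given by `f`. -/
def IsFO2Coloring {V : Type*} [DecidableEq V] (m : V → V → ℕ) (c : V → Bool) (f : V → V) :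
    Prop :=
  (∀ v, (∃ u, 0 < m v u ∧ c u = c v) → 0 < m v (f v) ∧ c (f v) = c v) ∧
  ∀ u v, u ≠ v → c u = c v →
    m u v ≤ (if f u = v then 1 else 0) + (if f v = u then 1 else 0)

/-- The edges of the multigraph with symmetric multiplicity function `w`. -/
abbrev MultiEdge {V : Type*} (w : V → V → ℕ) (hw : ∀ u v, w u v = w v u) : Type _ :=
  Σ e : Sym2 V, Fin (Sym2.lift ⟨w, hw⟩ e)

/-- The number of edges at a vertex is at most its degree. -/
theorem card_multiEdge_mem_le {V : Type*} [Fintype V] [DecidableEq V] (w : V → V → ℕ)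
    (hw : ∀ u v, w u v = w v u) (v : V) (S : Finset (MultiEdge w hw)) :
    (S.filter fun x => v ∈ x.1).card ≤ ∑ u, w v u := by
  classical
  let φ : (Σ u : V, Fin (w v u)) → MultiEdge w hw := fun p => ⟨s(v, p.1), p.2⟩
  have hsub : (S.filter fun x => v ∈ x.1) ⊆ Finset.univ.image φ := by
    rintro ⟨e, i⟩ hx
    obtain ⟨u, rfl⟩ := (Finset.mem_filter.1 hx).2
    exact Finset.mem_image.2 ⟨⟨u, i⟩, Finset.mem_univ _, rfl⟩
  calc _ ≤ (Finset.univ.image φ).card := Finset.card_le_card hsub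
    _ ≤ (Finset.univ : Finset (Σ u : V, Fin (w v u))).card := Finset.card_image_le
    _ = ∑ u, w v u := by simp

/-- In a loopless multigraph of maximum degree at most 2, distinct edges can be assigned
distinct endpoints. -/
theorem exists_injective_endpoint {V : Type*} [Fintype V] [DecidableEq V] (w : V → V → ℕ)
    (hw : ∀ u v, w u v = w v u) (hloop : ∀ v, w v v = 0) (hdeg : ∀ v, ∑ u, w v u ≤ 2) :
    ∃ g : MultiEdge w hw → V, Function.Injective g ∧ ∀ x, g x ∈ x.1 := by
  classical
  have hall := (Finset.all_card_le_biUnion_card_iff_exists_injective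
    (fun x : MultiEdge w hw => x.1.toFinset)).1 ?_
  · simpa using hall
  intro S
  have key := Finset.card_mul_le_card_mul (s := S) (t := S.biUnion fun x => x.1.toFinset)
    (m := 2) (n := 2) (fun x v => v ∈ x.1) ?_ ?_
  · omega
  · rintro ⟨e, i⟩ hx
    have hd : ¬ e.IsDiag := by
      induction e with
      | _ a b =>
        intro h
        obtain rfl : a = b := by simpa using h
        have hi : (i : ℕ) < w a a := i.2
        rw [hloop] at hi
        omega
    rw [← Sym2.card_toFinset_of_not_isDiag e hd]
    refine Finset.card_le_card fun v hv => ?_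
    exact Finset.mem_filter.2 ⟨Finset.mem_biUnion.2 ⟨_, hx, hv⟩, Sym2.mem_toFinset.1 hv⟩
  · intro v _
    exact (card_multiEdge_mem_le w hw v S).trans (hdeg v)

/-- A loopless multigraph of maximum degree at most 2 has a full functional orientation. -/
theorem exists_functional_orientation {V : Type*} [Fintype V] [DecidableEq V] (w : V → V → ℕ)
    (hw : ∀ u v, w u v = w v u) (hloop : ∀ v, w v v = 0) (hdeg : ∀ v, ∑ u, w v u ≤ 2) :
    ∃ f : V → V, (∀ v, (∃ u, 0 < w v u) → 0 < w v (f v)) ∧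
      ∀ u v, u ≠ v → w u v ≤ (if f u = v then 1 else 0) + (if f v = u then 1 else 0) := by
  obtain ⟨g, hg, hmem⟩ := exists_injective_endpoint w hw hloop hdeg
  have hex : ∀ v, ∃ y, (∀ x, g x = v → x.1 = s(v, y)) ∧ ((∃ u, 0 < w v u) → 0 < w v y) := by
    intro v
    by_cases hv : ∃ x, g x = v
    · obtain ⟨⟨e, i⟩, rfl⟩ := hv
      obtain ⟨y, hy⟩ := hmem ⟨e, i⟩
      refine ⟨y, fun x hx => hg hx ▸ hy, fun _ => ?_⟩
      have hi : (i : ℕ) < Sym2.lift ⟨w, hw⟩ e := i.2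
      have he : Sym2.lift ⟨w, hw⟩ e = w (g ⟨e, i⟩) y :=
        congrArg (Sym2.lift ⟨w, hw⟩) hy
      omega
    · by_cases hu : ∃ u, 0 < w v u
      · exact ⟨hu.choose, fun x hx => (hv ⟨x, hx⟩).elim, fun _ => hu.choose_spec⟩
      · exact ⟨v, fun x hx => (hv ⟨x, hx⟩).elim, fun h => (hu h).elim⟩
  choose f hf hpos using hex
  refine ⟨f, hpos, fun u v _ => ?_⟩
  have hcase : ∀ i : Fin (w u v), (g ⟨s(u, v), i⟩ = u ∧ f u = v) ∨
      (g ⟨s(u, v), i⟩ = v ∧ f v = u) := by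
    intro i
    rcases Sym2.mem_iff.1 (hmem ⟨s(u, v), i⟩) with h | h
    · exact .inl ⟨h, (Sym2.congr_right.1 (hf u _ h)).symm⟩
    · exact .inr ⟨h, (Sym2.congr_right.1 (Sym2.eq_swap.trans (hf v _ h))).symm⟩
  have hle : w u v ≤ 2 :=
    (Finset.single_le_sum (fun _ _ => Nat.zero_le _) (Finset.mem_univ v)).trans (hdeg u)
  have hone : 0 < w u v → f u = v ∨ f v = u := fun h =>
    (hcase ⟨0, h⟩).imp And.right And.right
  have htwo : 1 < w u v → f u = v ∧ f v = u := by
    intro h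
    have hne : g ⟨s(u, v), (⟨0, by omega⟩ : Fin (w u v))⟩ ≠
        g ⟨s(u, v), (⟨1, h⟩ : Fin (w u v))⟩ := by
      intro heq
      have hval := congrArg Fin.val (eq_of_heq (Sigma.mk.inj (hg heq)).2)
      exact absurd hval zero_ne_one
    rcases hcase ⟨0, by omega⟩ with h0 | h0 <;> rcases hcase ⟨1, h⟩ with h1 | h1
    · exact (hne (h0.1.trans h1.1.symm)).elim
    · exact ⟨h0.2, h1.2⟩
    · exact ⟨h1.2, h0.2⟩
    · exact (hne (h0.1.trans h1.1.symm)).elim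
  split_ifs with h1 h2 h2 <;> by_contra! hlt
  · omega
  · exact h2 (htwo (by omega)).2
  · exact h1 (htwo (by omega)).1
  · exact (hone (by omega)).elim h1 h2

/-- If every vertex of a finite multigraph `(V, m)` has at most 2 same-colored
neighbors (counted with multiplicity) under the coloring `c`, then `c` extends
to an FO-2-coloring of `(V, m)`. -/
theorem exists_fo2Coloring_of_mono_degree_le_two
    {V : Type*} [Fintype V] [DecidableEq V] (m : V → V → ℕ)
    (hsymm : ∀ u v, m u v = m v u) (hloop : ∀ v, m v v = 0)
    (c : V → Bool)
    (hmono : ∀ v, ∑ u ∈ Finset.univ.filter (fun u => c u = c v), m v u ≤ 2) :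
    ∃ f : V → V, IsFO2Coloring m c f := by
  obtain ⟨f, hpos, hle⟩ := exists_functional_orientation
    (fun v u => if c u = c v then m v u else 0)
    (fun u v => by simp only [hsymm u v, eq_comm]) (fun v => by simp [hloop])
    (fun v => by simpa only [Finset.sum_filter] using hmono v)
  refine ⟨f, fun v ⟨u, hu, hc⟩ => ?_, fun u v huv hc => ?_⟩
  · have h := hpos v ⟨u, by simpa [hc] using hu⟩
    by_cases hfc : c (f v) = c v
    · exact ⟨by simpa [hfc] using h, hfc⟩
    · simp [hfc] at h
  · simpa [hc] using hle u v huv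
end

section
/- Let (V, m) be a finite multigraph containing a VAR-gadget with external vertices x_1, …, x_n and x̄_1, …, x̄_m (n, m ≥ 1). Then every FO-2-coloring (c, f) of (V, m) satisfies c x_i = c x_1 for all 1 ≤ i ≤ n and c x̄_j = ¬(c x_1) for all 1 ≤ j ≤ m. -/
/-- The multiplicity matrix of the EQ-gadget on nine vertices, listed in the
order `x, y, γ, α, β, a, b, p, q` (indices `0, …, 8`):
`m x γ = m y γ = 2`, `m γ α = m γ β = m α β = 1`, `m α a = m α b = 2`,
`m a b = 3`, `m β p = m β q = 2`, `m p q = 3`, and `0` elsewhere. -/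
def eqM : Fin 9 → Fin 9 → ℕ :=
  ![![0,0,2,0,0,0,0,0,0],
    ![0,0,2,0,0,0,0,0,0],
    ![2,2,0,1,1,0,0,0,0],
    ![0,0,1,0,1,2,2,0,0],
    ![0,0,1,1,0,0,0,2,2],
    ![0,0,0,2,0,0,3,0,0],
    ![0,0,0,2,0,3,0,0,0],
    ![0,0,0,0,2,0,0,0,3],
    ![0,0,0,0,2,0,0,3,0]]

/-- `e` embeds an EQ-gadget into the multigraph `m`: the nine vertices
`e 0, …, e 8` are distinct, `m` takes exactly the EQ-gadget values on them,
and each of the seven internal vertices (indices `2, …, 8`) has `m`-value `0`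
to every vertex outside the nine. The external vertices are `e 0` and `e 1`. -/
def IsEQEmbedding {V : Type*} (m : V → V → ℕ) (e : Fin 9 → V) : Prop :=
  Function.Injective e ∧
  (∀ i j, m (e i) (e j) = eqM i j) ∧
  (∀ i : Fin 9, 2 ≤ (i : ℕ) → ∀ v, (∀ j, v ≠ e j) → m (e i) v = 0)

/-- The multigraph `m` contains an EQ-gadget with external vertices `x, y` and
set of internal vertices `S`. -/
def IsEQGadget {V : Type*} (m : V → V → ℕ) (x y : V) (S : Set V) : Prop :=
  ∃ e : Fin 9 → V, IsEQEmbedding m e ∧ e 0 = x ∧ e 1 = y ∧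
    S = {w | ∃ i : Fin 9, 2 ≤ (i : ℕ) ∧ e i = w}

/-- The multigraph `m` contains an NE-gadget with external vertices `x, y` and
set of internal vertices `S`: there are vertices `u, v` joined by a triple
edge, EQ-gadgets with external pairs `(x, u)` and `(y, v)` whose internal
vertices together with `x, y, u, v` are pairwise distinct, and `u` and `v`
have `m`-value `0` to every vertex other than each other and the vertices of
their respective EQ-gadgets. -/
def IsNEGadget {V : Type*} (m : V → V → ℕ) (x y : V) (S : Set V) : Prop :=
  ∃ (u v : V) (S₁ S₂ : Set V),
    m u v = 3 ∧
    IsEQGadget m x u S₁ ∧ IsEQGadget m y v S₂ ∧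
    List.Pairwise (· ≠ ·) [x, y, u, v] ∧
    Disjoint S₁ S₂ ∧ Disjoint ({x, y, u, v} : Set V) (S₁ ∪ S₂) ∧
    (∀ w, w ∉ S₁ → w ∉ ({x, u, v} : Set V) → m u w = 0) ∧
    (∀ w, w ∉ S₂ → w ∉ ({y, v, u} : Set V) → m v w = 0) ∧
    S = S₁ ∪ S₂ ∪ {u, v}

section FO2Coloring

variable {V : Type*} [DecidableEq V] {m : V → V → ℕ} {c : V → Bool} {f : V → V}

/-- Vertices joined by at least three parallel edges receive different colors. -/
theorem IsFO2Coloring.ne_of_three_le (h : IsFO2Coloring m c f) {u v : V} (huv : u ≠ v)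
    (hm : 3 ≤ m u v) : c u ≠ c v := by
  intro hc
  have := h.2 u v huv hc
  split_ifs at this <;> omega

/-- The two ends of a monochromatic double edge are oriented towards each other. -/
theorem IsFO2Coloring.eq_of_two_le (h : IsFO2Coloring m c f) {u v : V} (huv : u ≠ v)
    (hm : 2 ≤ m u v) (hc : c u = c v) : f u = v ∧ f v = u := by
  have := h.2 u v huv hc
  split_ifs at this <;> first | omega | exact ⟨by assumption, by assumption⟩

/-- A monochromatic edge is oriented in at least one direction. -/
theorem IsFO2Coloring.eq_or_eq_of_pos (h : IsFO2Coloring m c f) {u v : V} (huv : u ≠ v)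
    (hm : 0 < m u v) (hc : c u = c v) : f u = v ∨ f v = u := by
  have := h.2 u v huv hc
  by_contra! hne
  simp [hne.1, hne.2] at this
  omega

/-- A vertex joined by double edges to both ends of a triple edge is oriented towards
one of these ends. -/
theorem IsFO2Coloring.eq_or_eq_of_triple (h : IsFO2Coloring m c f) {w u v : V} (huv : u ≠ v)
    (hwu : w ≠ u) (hwv : w ≠ v) (hm : 3 ≤ m u v) (hmu : 2 ≤ m w u) (hmv : 2 ≤ m w v) :
    f w = u ∨ f w = v := by
  have hne := h.ne_of_three_le huv hm
  by_cases hc : c w = c u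
  · exact .inl (h.eq_of_two_le hwu hmu hc).1
  · refine .inr (h.eq_of_two_le hwv hmv ?_).1
    revert hne hc
    cases c w <;> cases c u <;> cases c v <;> simp

/-- The external vertices of an EQ-gadget receive the same color. -/
theorem IsEQGadget.color_eq {x y : V} {S : Set V} (hg : IsEQGadget m x y S)
    (h : IsFO2Coloring m c f) : c x = c y := by
  obtain ⟨e, ⟨hinj, hm, -⟩, rfl, rfl, -⟩ := hg
  have hne : ∀ {i j : Fin 9}, i ≠ j → e i ≠ e j := fun hij => hinj.ne hij
  have hα : f (e 3) = e 5 ∨ f (e 3) = e 6 := by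
    apply h.eq_or_eq_of_triple <;> first | exact hne (by decide) | (rw [hm]; decide)
  have hβ : f (e 4) = e 7 ∨ f (e 4) = e 8 := by
    apply h.eq_or_eq_of_triple <;> first | exact hne (by decide) | (rw [hm]; decide)
  have hα' : ∀ i : Fin 9, i ≠ 5 → i ≠ 6 → f (e 3) ≠ e i := by
    rintro i h5 h6 hi
    rcases hα with hα | hα
    · exact h5 (hinj (hi.symm.trans hα))
    · exact h6 (hinj (hi.symm.trans hα))
  have hβ' : ∀ i : Fin 9, i ≠ 7 → i ≠ 8 → f (e 4) ≠ e i := by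
    rintro i h7 h8 hi
    rcases hβ with hβ | hβ
    · exact h7 (hinj (hi.symm.trans hβ))
    · exact h8 (hinj (hi.symm.trans hβ))
  have hαβ : c (e 3) ≠ c (e 4) := fun hc =>
    (h.eq_or_eq_of_pos (hne (by decide)) (by rw [hm]; decide) hc).elim
      (hα' 4 (by decide) (by decide)) (hβ' 3 (by decide) (by decide))
  have hγ : f (e 2) = e 3 ∨ f (e 2) = e 4 := by
    by_cases hc : c (e 2) = c (e 3)
    · exact .inl ((h.eq_or_eq_of_pos (hne (by decide)) (by rw [hm]; decide) hc).resolve_right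
        (hα' 2 (by decide) (by decide)))
    · have hc' : c (e 2) = c (e 4) := by
        revert hc hαβ
        cases c (e 2) <;> cases c (e 3) <;> cases c (e 4) <;> simp
      exact .inr ((h.eq_or_eq_of_pos (hne (by decide)) (by rw [hm]; decide) hc').resolve_right
        (hβ' 2 (by decide) (by decide)))
  have hext : ∀ i : Fin 9, i ≠ 2 → i ≠ 3 → i ≠ 4 → 2 ≤ eqM 2 i → c (e 2) ≠ c (e i) := by
    intro i h2 h3 h4 h2i hc
    have hi := (h.eq_of_two_le (hne h2.symm) (by rwa [hm]) hc).1
    rcases hγ with hγ | hγ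
    · exact h3 (hinj (hi.symm.trans hγ))
    · exact h4 (hinj (hi.symm.trans hγ))
  have h0 := hext 0 (by decide) (by decide) (by decide) (by decide)
  have h1 := hext 1 (by decide) (by decide) (by decide) (by decide)
  revert h0 h1
  cases c (e 0) <;> cases c (e 1) <;> cases c (e 2) <;> simp

/-- The external vertices of an NE-gadget receive different colors. -/
theorem IsNEGadget.color_ne {x y : V} {S : Set V} (hg : IsNEGadget m x y S)
    (h : IsFO2Coloring m c f) : c x ≠ c y := by
  obtain ⟨u, v, S₁, S₂, huv, h₁, h₂, hpw, -⟩ := hg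
  have hne : u ≠ v := by
    simp only [List.pairwise_cons, List.mem_cons] at hpw
    exact hpw.2.2.1 v (.inl rfl)
  rw [h₁.color_eq h, h₂.color_eq h]
  exact h.ne_of_three_le hne huv.ge

/-- The vertices of a chain of EQ-gadgets all receive the color of the first one. -/
theorem color_eq_of_isEQGadget_chain {n : ℕ} (hn : 0 < n) {x : Fin n → V} {S : ℕ → Set V}
    (hx : ∀ i (h : i + 1 < n), IsEQGadget m (x ⟨i, by omega⟩) (x ⟨i + 1, h⟩) (S i))
    (h : IsFO2Coloring m c f) (i : Fin n) : c (x i) = c (x ⟨0, hn⟩) := by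
  obtain ⟨i, hi⟩ := i
  induction i with
  | zero => rfl
  | succ i ih => exact ((hx i hi).color_eq h).symm.trans (ih (by omega))

end FO2Coloring

/-- The VAR-gadget: suppose a finite multigraph contains a VAR-gadget with
external vertices `x 0, …, x (n-1)` and `xb 0, …, xb (k-1)` (`n, k ≥ 1`),
i.e. all these external vertices are pairwise distinct, consecutive `x`'s and
consecutive `xb`'s are joined by EQ-gadgets (internal sets `SX i`, `SY j`),
the last `x` and the last `xb` are joined by an NE-gadget (internal set `SN`),
and the internal vertex sets of all these gadgets are pairwise disjoint and
disjoint from the set of external vertices. Then every FO-2-coloring gives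
all the `x i` the color of `x 0` and all the `xb j` the opposite color. -/
theorem var_gadget
    {V : Type*} [Fintype V] [DecidableEq V] (m : V → V → ℕ)
    (hsymm : ∀ u v, m u v = m v u) (hloop : ∀ v, m v v = 0)
    {n k : ℕ} (hn : 1 ≤ n) (hk : 1 ≤ k)
    (x : Fin n → V) (xb : Fin k → V)
    (hdistinct : Function.Injective (Sum.elim x xb))
    (SX : ℕ → Set V) (SY : ℕ → Set V) (SN : Set V)
    (hEQx : ∀ i (h : i + 1 < n), IsEQGadget m (x ⟨i, by omega⟩) (x ⟨i + 1, h⟩) (SX i))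
    (hEQxb : ∀ j (h : j + 1 < k), IsEQGadget m (xb ⟨j, by omega⟩) (xb ⟨j + 1, h⟩) (SY j))
    (hNE : IsNEGadget m (x ⟨n - 1, by omega⟩) (xb ⟨k - 1, by omega⟩) SN)
    (hXX : ∀ i j, i + 1 < n → j + 1 < n → i ≠ j → Disjoint (SX i) (SX j))
    (hYY : ∀ i j, i + 1 < k → j + 1 < k → i ≠ j → Disjoint (SY i) (SY j))
    (hXY : ∀ i j, i + 1 < n → j + 1 < k → Disjoint (SX i) (SY j))
    (hXN : ∀ i, i + 1 < n → Disjoint (SX i) SN)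
    (hYN : ∀ j, j + 1 < k → Disjoint (SY j) SN)
    (hXext : ∀ i, i + 1 < n → Disjoint (SX i) (Set.range x ∪ Set.range xb))
    (hYext : ∀ j, j + 1 < k → Disjoint (SY j) (Set.range x ∪ Set.range xb))
    (hNext : Disjoint SN (Set.range x ∪ Set.range xb))
    (c : V → Bool) (f : V → V) (hcf : IsFO2Coloring m c f) :
    (∀ i : Fin n, c (x i) = c (x ⟨0, by omega⟩)) ∧
    (∀ j : Fin k, c (xb j) = !(c (x ⟨0, by omega⟩))) := by
  have hX := color_eq_of_isEQGadget_chain hn hEQx hcf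
  have hXb := color_eq_of_isEQGadget_chain hk hEQxb hcf
  refine ⟨hX, fun j => ?_⟩
  have hne := hNE.color_ne hcf
  rw [hX, hXb] at hne
  rw [hXb j]
  exact Bool.eq_not.mpr hne.symm
end
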